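/- Aldous–Hoover Theorem (parametric weak form): let W and X be standard Borel spaces and let p : W → (ℕ × ℕ → X) be a row-column exchangeable Markov kernel. Then there exist standard Borel spaces A, B, C and Markov kernels q : W → A, f : A → B, g : A → C, h : B × A × C → X such that for every w ∈ W, p(w) equals the law of the random array generated as follows: sample a ∼ q(w); sample (b_i)_{i∈ℕ} i.i.d. from f(a) and, independently, (c_j)_{j∈ℕ} i.i.d. from g(a); then, conditionally independently over all pairs (i,j), sample the (i,j)-entry from h(b_i, a, c_j). -/

import Mathlib

open MeasureTheory ProbabilityTheory

/-- `ν` is the product of the probability measures `μ i` over the (possibly infinite) index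
set `ι`: every finite-dimensional cylinder set has the product measure. (For probability
measures this characterizes the countable product measure uniquely.) -/
def IsProductMeasure {ι : Type*} {α : ι → Type*} [∀ i, MeasurableSpace (α i)]
    (μ : ∀ i, Measure (α i)) (ν : Measure (∀ i, α i)) : Prop :=
  ∀ (s : Finset ι) (t : ∀ i, Set (α i)), (∀ i, MeasurableSet (t i)) →
    ν {x | ∀ i ∈ s, x i ∈ t i} = ∏ i ∈ s, μ i (t i)

/-- A Markov kernel `p : W → (ℕ × ℕ → X)` is row-column exchangeable if for every
permutation `σ` of `ℕ` fixing all but finitely many elements and every `w`, the measure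
`p w` is invariant under permuting the rows by `σ` and under permuting the columns
by `σ`. -/
def RowColumnExchangeableKernel {W X : Type*} [MeasurableSpace W] [MeasurableSpace X]
    (p : Kernel W (ℕ × ℕ → X)) : Prop :=
  ∀ σ : Equiv.Perm ℕ, {n | σ n ≠ n}.Finite → ∀ w,
    (p w).map (fun x (ij : ℕ × ℕ) => x (σ ij.1, ij.2)) = p w ∧
    (p w).map (fun x (ij : ℕ × ℕ) => x (ij.1, σ ij.2)) = p w

/-- The kernel `p : W → (ℕ × ℕ → X)` admits, parametrically in `w`, an Aldous–Hoover
representation with standard Borel parameter spaces `A`, `B`, `C`: there are Markov kernels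
`q : W → A`, `f : A → B`, `g : A → C` and `h : B × A × C → X` such that for every `w`,
`p w` is the law of the array generated by sampling `a ∼ q w`, then `(b i)_{i ∈ ℕ}` i.i.d.
from `f a` and independently `(c j)_{j ∈ ℕ}` i.i.d. from `g a` (the kernels `F`, `G` give
the countable product measures `(f a)^{⊗ℕ}`, `(g a)^{⊗ℕ}`), and finally, conditionally
independently over all pairs `(i, j)`, the `(i,j)`-entry from `h (b i, a, c j)` (the kernel
`H` gives the corresponding product measure). -/
def IsParametricAldousHooverMixture {W X : Type*} [MeasurableSpace W] [MeasurableSpace X]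
    (p : Kernel W (ℕ × ℕ → X))
    (A B C : Type) [MeasurableSpace A] [MeasurableSpace B] [MeasurableSpace C] : Prop :=
  StandardBorelSpace A ∧ StandardBorelSpace B ∧ StandardBorelSpace C ∧
    ∃ (q : Kernel W A) (f : Kernel A B) (g : Kernel A C) (h : Kernel (B × A × C) X),
      IsMarkovKernel q ∧ IsMarkovKernel f ∧ IsMarkovKernel g ∧ IsMarkovKernel h ∧
        ∃ (F : Kernel A (ℕ → B)) (G : Kernel A (ℕ → C))
          (H : Kernel (A × (ℕ → B) × (ℕ → C)) (ℕ × ℕ → X)),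
          (∀ a, IsProductMeasure (fun _ : ℕ => f a) (F a)) ∧
          (∀ a, IsProductMeasure (fun _ : ℕ => g a) (G a)) ∧
          (∀ a b c,
            IsProductMeasure (fun ij : ℕ × ℕ => h (b ij.1, a, c ij.2)) (H (a, b, c))) ∧
          ∀ w, p w = (q w).bind (fun a => ((F a).prod (G a)).bind (fun bc => H (a, bc.1, bc.2)))

open scoped ENNReal

/-- Finite measures on a product space which agree on all square cylinders are equal. -/
theorem MeasureTheory.Measure.ext_of_squareCylinder {ι : Type*} {E : ι → Type*}
    [∀ i, MeasurableSpace (E i)] {μ ν : Measure (∀ i, E i)} [IsFiniteMeasure μ]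
    (h : ∀ (s : Finset ι) (t : ∀ i, Set (E i)), (∀ i, MeasurableSet (t i)) →
      μ {x | ∀ i ∈ s, x i ∈ t i} = ν {x | ∀ i ∈ s, x i ∈ t i}) : μ = ν := by
  refine ext_of_generate_finite _ generateFrom_squareCylinders.symm
    (isPiSystem_squareCylinders (fun _ ↦ MeasurableSpace.isPiSystem_measurableSet) (by simp)) ?_ ?_
  · rintro _ ⟨s, t, ht, rfl⟩
    exact h s t fun i => ht i trivial
  · simpa using h ∅ (fun _ => Set.univ) fun _ => MeasurableSet.univ

theorem measurableSet_squareCylinder {ι : Type*} {E : ι → Type*} [∀ i, MeasurableSpace (E i)]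
    (s : Finset ι) {t : ∀ i, Set (E i)} (ht : ∀ i, MeasurableSet (t i)) :
    MeasurableSet {x : ∀ i, E i | ∀ i ∈ s, x i ∈ t i} :=
  MeasurableSet.pi s.countable_toSet fun i _ => ht i

/-- The kernel sending `a` to the product of the probability measures `κ i a`. -/
noncomputable def ProbabilityTheory.Kernel.infinitePi {α ι : Type*} {E : ι → Type*}
    [MeasurableSpace α] [∀ i, MeasurableSpace (E i)] (κ : ∀ i, Kernel α (E i))
    [∀ i, IsMarkovKernel (κ i)] : Kernel α (∀ i, E i) where
  toFun a := Measure.infinitePi fun i => κ i a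
  measurable' := by
    refine Measurable.measure_of_isPiSystem_of_isProbabilityMeasure
      generateFrom_squareCylinders.symm
      (isPiSystem_squareCylinders (fun _ ↦ MeasurableSpace.isPiSystem_measurableSet) (by simp)) ?_
    rintro _ ⟨s, t, ht, rfl⟩
    simp_rw [Measure.infinitePi_pi _ fun i _ => ht i trivial]
    exact Finset.measurable_prod _ fun i _ => (κ i).measurable_coe (ht i trivial)

namespace ProbabilityTheory.Kernel

variable {α ι : Type*} {E : ι → Type*} [MeasurableSpace α] [∀ i, MeasurableSpace (E i)]
  (κ : ∀ i, Kernel α (E i)) [∀ i, IsMarkovKernel (κ i)]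

instance : IsMarkovKernel (infinitePi κ) :=
  ⟨fun a => inferInstanceAs (IsProbabilityMeasure (Measure.infinitePi fun i => κ i a))⟩

theorem infinitePi_apply_squareCylinder (a : α) (s : Finset ι) (t : ∀ i, Set (E i))
    (ht : ∀ i, MeasurableSet (t i)) :
    infinitePi κ a {x | ∀ i ∈ s, x i ∈ t i} = ∏ i ∈ s, κ i a (t i) :=
  Measure.infinitePi_pi (fun i => κ i a) fun i _ => ht i

end ProbabilityTheory.Kernel

theorem ENNReal.tsub_sq_add_tsub_sq {x y : ℝ≥0∞} (hx : x ≠ ∞) (hy : y ≠ ∞) :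
    ((x - y) ^ 2 + (y - x) ^ 2) + 2 * (x * y) = x ^ 2 + y ^ 2 := by
  lift x to NNReal using hx
  lift y to NNReal using hy
  norm_cast
  rcases le_total x y with h | h
  · obtain ⟨z, rfl⟩ := exists_add_of_le h
    simp only [add_tsub_cancel_left, tsub_eq_zero_of_le h]
    ring
  · obtain ⟨z, rfl⟩ := exists_add_of_le h
    simp only [add_tsub_cancel_left, tsub_eq_zero_of_le h]
    ring

theorem MeasureTheory.ae_eq_of_lintegral_sq_eq {Ω : Type*} [MeasurableSpace Ω] {P : Measure Ω}
    [IsFiniteMeasure P] {x y : Ω → ℝ≥0∞} (hx : Measurable x) (hy : Measurable y)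
    (hx1 : ∀ ω, x ω ≤ 1) (hy1 : ∀ ω, y ω ≤ 1)
    (h1 : ∫⁻ ω, x ω ^ 2 ∂P = ∫⁻ ω, x ω * y ω ∂P)
    (h2 : ∫⁻ ω, y ω ^ 2 ∂P = ∫⁻ ω, x ω * y ω ∂P) : x =ᵐ[P] y := by
  have hfin : ∫⁻ ω, x ω * y ω ∂P ≠ ∞ := by
    refine ((lintegral_mono fun ω => mul_le_one' (hx1 ω) (hy1 ω)).trans_lt ?_).ne
    simp
  have key : ∫⁻ ω, ((x ω - y ω) ^ 2 + (y ω - x ω) ^ 2) ∂P + 2 * ∫⁻ ω, x ω * y ω ∂P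
      = 2 * ∫⁻ ω, x ω * y ω ∂P := by
    rw [← lintegral_const_mul _ (by fun_prop), ← lintegral_add_left (by fun_prop)]
    simp_rw [ENNReal.tsub_sq_add_tsub_sq ((hx1 _).trans_lt ENNReal.one_lt_top).ne
      ((hy1 _).trans_lt ENNReal.one_lt_top).ne]
    rw [lintegral_add_left (by fun_prop), h1, h2, lintegral_const_mul _ (by fun_prop), two_mul]
  have h0 : ∫⁻ ω, ((x ω - y ω) ^ 2 + (y ω - x ω) ^ 2) ∂P = 0 :=
    (ENNReal.add_left_inj (by finiteness)).1 (key.trans (zero_add _).symm)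
  rw [lintegral_eq_zero_iff (by fun_prop)] at h0
  filter_upwards [h0] with ω hω
  simp only [Pi.zero_apply, add_eq_zero, pow_eq_zero_iff two_ne_zero, tsub_eq_zero_iff_le] at hω
  exact le_antisymm hω.1 hω.2

/-- Suppose that `η` is a function of `ζ`, and that a measure-preserving map `T` fixes the event
`D` and carries `ζ` to a function of `η`. Then `D` is conditionally independent of `ζ`
given `η`. -/
theorem MeasureTheory.setLIntegral_eq_of_contraction {Ω F G : Type*} [MeasurableSpace Ω]
    [MeasurableSpace F] [MeasurableSpace G] {P : Measure Ω} [IsFiniteMeasure P]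
    {T : Ω → Ω} (hT : MeasurePreserving T P P) {ζ : Ω → G} (hζ : Measurable ζ)
    {π : G → F} (hπ : Measurable π) {ρ : F → G} (hρ : Measurable ρ)
    (hT_comp : ∀ ω, ζ (T ω) = ρ (π (ζ ω))) {D : Set Ω} (hD : MeasurableSet D)
    (hTD : T ⁻¹' D = D) {k : F → ℝ≥0∞} (hk : Measurable k)
    (hkD : ∀ S, MeasurableSet S →
      P ((fun ω => π (ζ ω)) ⁻¹' S ∩ D) = ∫⁻ ω in (fun ω => π (ζ ω)) ⁻¹' S, k (π (ζ ω)) ∂P)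
    {Z : G → ℝ≥0∞} (hZ : Measurable Z) :
    ∫⁻ ω in D, Z (ζ ω) ∂P = ∫⁻ ω, Z (ζ ω) * k (π (ζ ω)) ∂P := by
  have hη : Measurable fun ω => π (ζ ω) := hπ.comp hζ
  obtain ⟨m, hm, hm1, hmD⟩ : ∃ m : G → ℝ≥0∞, Measurable m ∧ (∀ z, m z ≤ 1) ∧
      ∀ φ : G → ℝ≥0∞, Measurable φ →
        ∫⁻ ω in D, φ (ζ ω) ∂P = ∫⁻ ω, m (ζ ω) * φ (ζ ω) ∂P := by
    have hle : (P.restrict D).map ζ ≤ P.map ζ := Measure.map_mono Measure.restrict_le_self hζ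
    set d := ((P.restrict D).map ζ).rnDeriv (P.map ζ)
    have hdm : Measurable d := Measure.measurable_rnDeriv _ _
    have hd1 : d ≤ᵐ[P.map ζ] 1 := Measure.rnDeriv_le_one_of_le hle
    refine ⟨fun z => min (d z) 1, by fun_prop, fun z => min_le_right _ _, fun φ hφ => ?_⟩
    rw [← lintegral_map hφ hζ, ← Measure.withDensity_rnDeriv_eq _ _ hle.absolutelyContinuous,
      lintegral_withDensity_eq_lintegral_mul _ hdm hφ,
      ← lintegral_map (f := fun z => min (d z) 1 * φ z) (by fun_prop) hζ]
    refine lintegral_congr_ae ?_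
    filter_upwards [hd1] with z hz
    rw [Pi.mul_apply, min_eq_left (show d z ≤ 1 from hz)]
  have hmD' : ∀ φ : G → ℝ≥0∞, Measurable φ →
      ∫⁻ ω in D, φ (ρ (π (ζ ω))) ∂P = ∫⁻ ω, m (ρ (π (ζ ω))) * φ (ρ (π (ζ ω))) ∂P := by
    intro φ hφ
    simp_rw [← hT_comp]
    rw [hT.lintegral_comp (f := fun ω => m (ζ ω) * φ (ζ ω)) (by fun_prop), ← hmD φ hφ]
    conv_lhs => rw [← hTD]
    exact hT.setLIntegral_comp_preimage hD (hφ.comp hζ)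
  have hae : (fun ω => m (ζ ω)) =ᵐ[P] fun ω => m (ρ (π (ζ ω))) := by
    have hcross : ∫⁻ ω, m (ρ (π (ζ ω))) ^ 2 ∂P = ∫⁻ ω, m (ζ ω) * m (ρ (π (ζ ω))) ∂P := by
      rw [← hmD (fun z => m (ρ (π z))) (by fun_prop), hmD' m hm]
      simp_rw [sq]
    refine ae_eq_of_lintegral_sq_eq (by fun_prop) (by fun_prop) (fun _ => hm1 _)
      (fun _ => hm1 _) ?_ hcross
    rw [← hcross]
    simp_rw [← hT_comp]
    exact (hT.lintegral_comp (f := fun ω => m (ζ ω) ^ 2) (by fun_prop)).symm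
  have hk_ae : k =ᵐ[P.map fun ω => π (ζ ω)] fun y => m (ρ y) := by
    refine ae_eq_of_forall_setLIntegral_eq_of_sigmaFinite hk (by fun_prop) fun S hS _ => ?_
    rw [setLIntegral_map hS hk hη, setLIntegral_map hS (by fun_prop) hη, ← hkD S hS]
    have := hmD (fun z => (π ⁻¹' S).indicator 1 z) (measurable_one.indicator (hπ hS))
    have hS' : MeasurableSet ((fun ω => π (ζ ω)) ⁻¹' S) := hη hS
    calc P ((fun ω => π (ζ ω)) ⁻¹' S ∩ D)
        = ∫⁻ ω in D, (π ⁻¹' S).indicator 1 (ζ ω) ∂P := by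
          rw [← Measure.restrict_apply hS', ← lintegral_indicator_one hS']
          rfl
      _ = ∫⁻ ω, m (ζ ω) * (π ⁻¹' S).indicator 1 (ζ ω) ∂P := this
      _ = ∫⁻ ω, ((fun ω => π (ζ ω)) ⁻¹' S).indicator (fun ω => m (ρ (π (ζ ω)))) ω ∂P := by
          refine lintegral_congr_ae ?_
          filter_upwards [hae] with ω hω
          by_cases h : π (ζ ω) ∈ S <;> simp [Set.indicator, h, hω]
      _ = _ := lintegral_indicator hS' _
  rw [hmD Z hZ]
  refine lintegral_congr_ae ?_
  filter_upwards [hae, ae_of_ae_map hη.aemeasurable hk_ae] with ω h1 h2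
  rw [h1, h2, mul_comm]

section CondLaw

variable {Ω Y : Type*} [MeasurableSpace Ω] [MeasurableSpace Y] {P : Measure Ω} [IsFiniteMeasure P]

theorem MeasureTheory.setLIntegral_eq_of_map_prodMk_eq_compProd {E : Type*} [MeasurableSpace E]
    {y : Ω → Y} (hy : Measurable y) {x : Ω → E} (hx : Measurable x) {κ : Kernel Y E}
    [IsMarkovKernel κ] (h : P.map (fun ω => (y ω, x ω)) = P.map y ⊗ₘ κ) {D : Set E}
    (hD : MeasurableSet D) {Z : Y → ℝ≥0∞} (hZ : Measurable Z) :
    ∫⁻ ω in x ⁻¹' D, Z (y ω) ∂P = ∫⁻ ω, Z (y ω) * κ (y ω) D ∂P := by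
  have hΦ : Measurable fun p : Y × E => Z p.1 * D.indicator 1 p.2 :=
    (hZ.comp measurable_fst).mul ((measurable_one.indicator hD).comp measurable_snd)
  have hκ : Measurable fun z => κ z D := κ.measurable_coe hD
  calc ∫⁻ ω in x ⁻¹' D, Z (y ω) ∂P
      = ∫⁻ ω, Z (y ω) * D.indicator 1 (x ω) ∂P := by
        rw [← lintegral_indicator (hx hD)]
        refine lintegral_congr fun ω => ?_
        by_cases hω : x ω ∈ D <;> simp [hω]
    _ = ∫⁻ p, Z p.1 * D.indicator 1 p.2 ∂(P.map fun ω => (y ω, x ω)) :=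
        (lintegral_map hΦ (hy.prodMk hx)).symm
    _ = ∫⁻ z, Z z * κ z D ∂(P.map y) := by
        rw [h, Measure.lintegral_compProd hΦ]
        refine lintegral_congr fun z => ?_
        dsimp only
        rw [lintegral_const_mul _ (measurable_one.indicator hD), lintegral_indicator_one hD]
    _ = ∫⁻ ω, Z (y ω) * κ (y ω) D ∂P := lintegral_map (by fun_prop) hy

theorem MeasureTheory.measure_inter_preimage_eq_of_map_prodMk_eq_compProd {E : Type*}
    [MeasurableSpace E] {y : Ω → Y} (hy : Measurable y) {x : Ω → E} (hx : Measurable x)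
    {κ : Kernel Y E} [IsMarkovKernel κ] (h : P.map (fun ω => (y ω, x ω)) = P.map y ⊗ₘ κ)
    {S : Set Y} (hS : MeasurableSet S) {D : Set E} (hD : MeasurableSet D) :
    P (y ⁻¹' S ∩ x ⁻¹' D) = ∫⁻ ω in y ⁻¹' S, κ (y ω) D ∂P := by
  have := congrArg (fun μ => μ (S ×ˢ D)) h
  rw [Measure.map_apply (hy.prodMk hx) (hS.prod hD), Measure.compProd_apply_prod hS hD,
    setLIntegral_map hS (κ.measurable_coe hD) hy] at this
  exact this

theorem MeasureTheory.map_prodMk_eq_compProd_of_squareCylinder {ι : Type*} {E : ι → Type*}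
    [∀ i, MeasurableSpace (E i)] {y : Ω → Y} (hy : Measurable y) {x : Ω → ∀ i, E i}
    (hx : Measurable x) {κ : Kernel Y (∀ i, E i)} [IsMarkovKernel κ]
    (h : ∀ (S : Set Y), MeasurableSet S → ∀ (s : Finset ι) (t : ∀ i, Set (E i)),
      (∀ i, MeasurableSet (t i)) →
      ∫⁻ ω in x ⁻¹' {z | ∀ i ∈ s, z i ∈ t i}, S.indicator 1 (y ω) ∂P
        = ∫⁻ ω, S.indicator 1 (y ω) * κ (y ω) {z | ∀ i ∈ s, z i ∈ t i} ∂P) :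
    P.map (fun ω => (y ω, x ω)) = P.map y ⊗ₘ κ := by
  refine Measure.ext_prod fun {S D} hS hD => ?_
  rw [Measure.map_apply (hy.prodMk hx) (hS.prod hD), Measure.compProd_apply_prod hS hD]
  suffices hm : (P.restrict (y ⁻¹' S)).map x = ((P.map y).restrict S).bind κ by
    have := congrArg (fun μ => μ D) hm
    rw [Measure.map_apply hx hD, Measure.restrict_apply (hx hD),
      Measure.bind_apply hD κ.aemeasurable] at this
    rw [← this, Set.inter_comm]
    rfl
  refine Measure.ext_of_squareCylinder fun s t ht => ?_
  have hC := measurableSet_squareCylinder s ht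
  have hκ : Measurable fun z => κ z {z | ∀ i ∈ s, z i ∈ t i} := κ.measurable_coe hC
  have hyS : MeasurableSet (y ⁻¹' S) := hy hS
  have := h S hS s t ht
  rw [Measure.map_apply hx hC, Measure.bind_apply hC κ.aemeasurable,
    Measure.restrict_apply (hx hC), setLIntegral_map hS hκ hy]
  calc P (x ⁻¹' {z | ∀ i ∈ s, z i ∈ t i} ∩ y ⁻¹' S)
      = ∫⁻ ω in x ⁻¹' {z | ∀ i ∈ s, z i ∈ t i}, S.indicator 1 (y ω) ∂P := by
        rw [Set.inter_comm, ← Measure.restrict_apply hyS, ← lintegral_indicator_one hyS]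
        rfl
    _ = ∫⁻ ω, S.indicator 1 (y ω) * κ (y ω) {z | ∀ i ∈ s, z i ∈ t i} ∂P := this
    _ = _ := by
        rw [← lintegral_indicator hyS]
        refine lintegral_congr fun ω => ?_
        by_cases hω : y ω ∈ S <;> simp [hω]

/-- If each `x i` is conditionally independent of the other coordinates given `y`, with
conditional law `κ i`, then the conditional law of `x` given `y` is the product of the `κ i`. -/
theorem MeasureTheory.map_prodMk_eq_compProd_infinitePi {ι : Type*} {E : ι → Type*}
    [∀ i, MeasurableSpace (E i)] {y : Ω → Y} (hy : Measurable y) {x : Ω → ∀ i, E i}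
    (hx : Measurable x) (κ : ∀ i, Kernel Y (E i)) [∀ i, IsMarkovKernel (κ i)]
    (h : ∀ (i : ι) (D : Set (E i)), MeasurableSet D → ∀ (s : Finset ι), i ∉ s →
      ∀ (t : ∀ i, Set (E i)), (∀ i, MeasurableSet (t i)) →
      ∀ u : Y → ℝ≥0∞, Measurable u →
      ∫⁻ ω in (fun ω => x ω i) ⁻¹' D, u (y ω) * ∏ l ∈ s, (t l).indicator 1 (x ω l) ∂P
        = ∫⁻ ω, (u (y ω) * ∏ l ∈ s, (t l).indicator 1 (x ω l)) * κ i (y ω) D ∂P) :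
    P.map (fun ω => (y ω, x ω)) = P.map y ⊗ₘ Kernel.infinitePi κ := by
  classical
  have hxi : ∀ i, Measurable fun ω => x ω i := fun i => (measurable_pi_apply i).comp hx
  have key : ∀ (s : Finset ι) (t : ∀ i, Set (E i)), (∀ i, MeasurableSet (t i)) →
      ∀ u : Y → ℝ≥0∞, Measurable u →
      ∫⁻ ω, u (y ω) * ∏ l ∈ s, (t l).indicator 1 (x ω l) ∂P
        = ∫⁻ ω, u (y ω) * ∏ l ∈ s, κ l (y ω) (t l) ∂P := by
    intro s t ht
    induction s using Finset.induction_on with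
    | empty => simp
    | insert i s hi ih =>
      intro u hu
      simp_rw [Finset.prod_insert hi]
      calc ∫⁻ ω, u (y ω) * ((t i).indicator 1 (x ω i) * ∏ l ∈ s, (t l).indicator 1 (x ω l)) ∂P
          = ∫⁻ ω in (fun ω => x ω i) ⁻¹' (t i),
              u (y ω) * ∏ l ∈ s, (t l).indicator 1 (x ω l) ∂P := by
            rw [← lintegral_indicator (hxi i (ht i))]
            refine lintegral_congr fun ω => ?_
            by_cases hω : x ω i ∈ t i <;> simp [hω]
        _ = ∫⁻ ω, (u (y ω) * κ i (y ω) (t i)) * ∏ l ∈ s, (t l).indicator 1 (x ω l) ∂P := by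
            rw [h i (t i) (ht i) s hi t ht u hu]
            simp_rw [mul_right_comm]
        _ = ∫⁻ ω, u (y ω) * (κ i (y ω) (t i) * ∏ l ∈ s, κ l (y ω) (t l)) ∂P := by
            rw [ih (fun z => u z * κ i z (t i)) (hu.mul ((κ i).measurable_coe (ht i)))]
            simp_rw [mul_assoc]
  refine map_prodMk_eq_compProd_of_squareCylinder hy hx fun S hS s t ht => ?_
  simp_rw [Kernel.infinitePi_apply_squareCylinder κ _ s t ht]
  rw [← key s t ht _ (measurable_one.indicator hS),
    ← lintegral_indicator (hx (measurableSet_squareCylinder s ht))]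
  refine lintegral_congr fun ω => ?_
  by_cases hω : ∀ i ∈ s, x ω i ∈ t i
  · rw [Set.indicator_of_mem (by exact hω), Finset.prod_congr rfl fun i hi =>
      Set.indicator_of_mem (hω i hi) _]
    simp
  · rw [Set.indicator_of_notMem (by exact hω)]
    push Not at hω
    obtain ⟨i, hi, hit⟩ := hω
    rw [Finset.prod_eq_zero hi (Set.indicator_of_notMem hit _), mul_zero]

end CondLaw

/-- A parametrized regular conditional distribution of `x` given `y`. -/
theorem ProbabilityTheory.Kernel.exists_condLaw {Γ Ω F E : Type*} [MeasurableSpace Γ]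
    [MeasurableSpace Ω] [MeasurableSpace F] [MeasurableSpace E] [StandardBorelSpace F]
    [StandardBorelSpace E] [Nonempty E] (p : Kernel Γ Ω) [IsMarkovKernel p] {y : Ω → F}
    (hy : Measurable y) {x : Ω → E} (hx : Measurable x) :
    ∃ κ : Kernel (Γ × F) E, IsMarkovKernel κ ∧
      ∀ r, (p r).map (fun ω => (y ω, x ω)) = (p r).map y ⊗ₘ κ.sectR r := by
  have hyx := hy.prodMk hx
  obtain ⟨K, hK⟩ : ∃ K : Kernel Γ (F × E), K = p.map fun ω => (y ω, x ω) := ⟨_, rfl⟩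
  have : IsMarkovKernel K := hK ▸ Kernel.IsMarkovKernel.map p hyx
  refine ⟨K.condKernel, inferInstance, fun r => ?_⟩
  have h := DFunLike.congr_fun (K.disintegrate K.condKernel) r
  rw [Kernel.compProd_apply_eq_compProd_sectR, Kernel.fst_apply] at h
  have hr : K r = (p r).map fun ω => (y ω, x ω) := by rw [hK, Kernel.map_apply _ hyx]
  rw [hr, Measure.map_map measurable_fst hyx] at h
  exact h.symm

theorem Function.Injective.exists_perm_eqOn_finset {σ : ℕ → ℕ} (hσ : Function.Injective σ)
    (s : Finset ℕ) : ∃ π : Equiv.Perm ℕ, {n | π n ≠ n}.Finite ∧ ∀ r ∈ s, π r = σ r := by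
  induction s using Finset.induction_on with
  | empty => exact ⟨1, by simp, by simp⟩
  | insert r s hr ih =>
    obtain ⟨π, hπ, hπs⟩ := ih
    refine ⟨Equiv.swap (π r) (σ r) * π, ?_, fun n hn => ?_⟩
    · refine (hπ.union (Set.toFinite {π r, σ r})).subset fun n hn => ?_
      by_contra! h
      simp only [Set.mem_union, Set.mem_ofPred_eq, Set.mem_insert_iff, Set.mem_singleton_iff,
        not_or, not_not] at h
      apply hn
      rw [Equiv.Perm.mul_apply, h.1, Equiv.swap_apply_of_ne_of_ne h.2.1 h.2.2]
    · rcases Finset.mem_insert.1 hn with rfl | hn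
      · simp
      · rw [Equiv.Perm.mul_apply, Equiv.swap_apply_of_ne_of_ne, hπs n hn]
        · exact fun h => hr (π.injective h ▸ hn)
        · rw [hπs n hn]
          exact fun h => hr (hσ h ▸ hn)

/-- A law of arrays invariant under finitely supported permutations of the rows and of the columns
is invariant under passing to the subarray along injections. -/
theorem measurePreserving_subarray {X : Type*} [MeasurableSpace X]
    {P : Measure (ℕ × ℕ → X)} [IsFiniteMeasure P]
    (hP : ∀ σ : Equiv.Perm ℕ, {n | σ n ≠ n}.Finite →
      P.map (fun x (ij : ℕ × ℕ) => x (σ ij.1, ij.2)) = P ∧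
      P.map (fun x (ij : ℕ × ℕ) => x (ij.1, σ ij.2)) = P)
    {σ τ : ℕ → ℕ} (hσ : Function.Injective σ) (hτ : Function.Injective τ) :
    MeasurePreserving (fun x (ij : ℕ × ℕ) => x (σ ij.1, τ ij.2)) P P := by
  have hm : ∀ φ : ℕ × ℕ → ℕ × ℕ, Measurable fun (x : ℕ × ℕ → X) ij => x (φ ij) :=
    fun φ => measurable_pi_lambda _ fun ij => measurable_pi_apply _
  have hrow : MeasurePreserving (fun (x : ℕ × ℕ → X) (ij : ℕ × ℕ) => x (σ ij.1, ij.2)) P P := by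
    refine ⟨hm fun ij => (σ ij.1, ij.2), Measure.ext_of_squareCylinder fun s t ht => ?_⟩
    obtain ⟨π, hπ, hπs⟩ := hσ.exists_perm_eqOn_finset (s.image Prod.fst)
    have hC := measurableSet_squareCylinder s ht
    conv_rhs => rw [← (hP π hπ).1, Measure.map_apply (hm fun ij => (π ij.1, ij.2)) hC]
    rw [Measure.map_apply (hm fun ij => (σ ij.1, ij.2)) hC]
    congr 1
    ext x
    refine forall₂_congr fun ij hij => ?_
    dsimp only
    rw [hπs _ (Finset.mem_image_of_mem _ hij)]
  have hcol : MeasurePreserving (fun (x : ℕ × ℕ → X) (ij : ℕ × ℕ) => x (ij.1, τ ij.2)) P P := by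
    refine ⟨hm fun ij => (ij.1, τ ij.2), Measure.ext_of_squareCylinder fun s t ht => ?_⟩
    obtain ⟨π, hπ, hπs⟩ := hτ.exists_perm_eqOn_finset (s.image Prod.snd)
    have hC := measurableSet_squareCylinder s ht
    conv_rhs => rw [← (hP π hπ).2, Measure.map_apply (hm fun ij => (ij.1, π ij.2)) hC]
    rw [Measure.map_apply (hm fun ij => (ij.1, τ ij.2)) hC]
    congr 1
    ext x
    refine forall₂_congr fun ij hij => ?_
    dsimp only
    rw [hπs _ (Finset.mem_image_of_mem _ hij)]
  exact hcol.comp hrow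

/-- The array with rows and columns interchanged. -/
def transposeArray (z : ℕ → ℕ → ℝ) : ℕ → ℕ → ℝ := fun r s => z s r

/-- The subarray of even rows and even columns. -/
def evenCorner (z : ℕ → ℕ → ℝ) : ℕ → ℕ → ℝ := fun r s => z (2 * r) (2 * s)

/-- The even columns of the `i`-th odd row. -/
def oddRow (i : ℕ) (z : ℕ → ℕ → ℝ) : ℕ → ℝ := fun s => z (2 * i + 1) (2 * s)

/-- The even rows of the `j`-th odd column. -/
def oddCol (j : ℕ) (z : ℕ → ℕ → ℝ) : ℕ → ℝ := fun r => z (2 * r) (2 * j + 1)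

/-- The array with its `i`-th odd row overwritten by zeros. -/
def eraseOddRow (i : ℕ) (z : ℕ → ℕ → ℝ) : ℕ → ℕ → ℝ :=
  fun r s => if r = 2 * i + 1 then 0 else z r s

/-- The array with its `j`-th odd column overwritten by zeros. -/
def eraseOddCol (j : ℕ) (z : ℕ → ℕ → ℝ) : ℕ → ℕ → ℝ :=
  fun r s => if s = 2 * j + 1 then 0 else z r s

/-- The array with the entry in its `i`-th odd row and `j`-th odd column overwritten by zero. -/
def eraseOddEntry (i j : ℕ) (z : ℕ → ℕ → ℝ) : ℕ → ℕ → ℝ :=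
  fun r s => if r = 2 * i + 1 ∧ s = 2 * j + 1 then 0 else z r s

theorem measurable_array {Ω : Type*} [MeasurableSpace Ω] {f : Ω → ℕ → ℕ → ℝ}
    (hf : ∀ r s, Measurable fun ω => f ω r s) : Measurable f :=
  measurable_pi_lambda _ fun r => measurable_pi_lambda _ fun s => hf r s

theorem measurable_array_apply (r s : ℕ) : Measurable fun z : ℕ → ℕ → ℝ => z r s :=
  (measurable_pi_apply s).comp (measurable_pi_apply r)

@[fun_prop]
theorem measurable_evenCorner : Measurable evenCorner :=
  measurable_array fun _ _ => measurable_array_apply _ _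

@[fun_prop]
theorem measurable_oddRow (i : ℕ) : Measurable (oddRow i) :=
  measurable_pi_lambda _ fun _ => measurable_array_apply _ _

@[fun_prop]
theorem measurable_oddCol (j : ℕ) : Measurable (oddCol j) :=
  measurable_pi_lambda _ fun _ => measurable_array_apply _ _

@[fun_prop]
theorem measurable_transposeArray : Measurable transposeArray :=
  measurable_array fun _ _ => measurable_array_apply _ _

@[fun_prop]
theorem measurable_eraseOddRow (i : ℕ) : Measurable (eraseOddRow i) :=
  measurable_array fun r s => by unfold eraseOddRow; split_ifs <;> fun_prop

@[fun_prop]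
theorem measurable_eraseOddEntry (i j : ℕ) : Measurable (eraseOddEntry i j) :=
  measurable_array fun r s => by unfold eraseOddEntry; split_ifs <;> fun_prop

theorem evenCorner_eraseOddRow (i : ℕ) (z : ℕ → ℕ → ℝ) :
    evenCorner (eraseOddRow i z) = evenCorner z := by
  ext r s
  exact if_neg (by omega)

theorem oddRow_eraseOddRow {i l : ℕ} (h : l ≠ i) (z : ℕ → ℕ → ℝ) :
    oddRow l (eraseOddRow i z) = oddRow l z := by
  ext s
  exact if_neg (by omega)

theorem oddCol_eraseOddRow (i j : ℕ) (z : ℕ → ℕ → ℝ) :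
    oddCol j (eraseOddRow i z) = oddCol j z := by
  ext r
  exact if_neg (by omega)

theorem evenCorner_eraseOddCol (j : ℕ) (z : ℕ → ℕ → ℝ) :
    evenCorner (eraseOddCol j z) = evenCorner z := by
  ext r s
  exact if_neg (by omega)

theorem oddCol_eraseOddCol {j l : ℕ} (h : l ≠ j) (z : ℕ → ℕ → ℝ) :
    oddCol l (eraseOddCol j z) = oddCol l z := by
  ext r
  exact if_neg (by omega)

theorem evenCorner_eraseOddEntry (i j : ℕ) (z : ℕ → ℕ → ℝ) :
    evenCorner (eraseOddEntry i j z) = evenCorner z := by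
  ext r s
  exact if_neg (by omega)

theorem oddRow_eraseOddEntry (i j l : ℕ) (z : ℕ → ℕ → ℝ) :
    oddRow l (eraseOddEntry i j z) = oddRow l z := by
  ext s
  exact if_neg (by omega)

theorem oddCol_eraseOddEntry (i j l : ℕ) (z : ℕ → ℕ → ℝ) :
    oddCol l (eraseOddEntry i j z) = oddCol l z := by
  ext r
  exact if_neg (by omega)

/-- Given the even corner of a separately exchangeable array, the `i`-th odd row is independent of
all other rows, and its conditional law does not depend on `i`. -/
theorem setLIntegral_oddRow {Ω : Type*} [MeasurableSpace Ω] {P : Measure Ω} [IsFiniteMeasure P]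
    {v : Ω → ℕ → ℕ → ℝ} (hv : Measurable v)
    (hT : ∀ σ τ : ℕ → ℕ, Function.Injective σ → Function.Injective τ →
      ∃ T, MeasurePreserving T P P ∧ ∀ ω r s, v (T ω) r s = v ω (σ r) (τ s))
    {κ : Kernel (ℕ → ℕ → ℝ) (ℕ → ℝ)} [IsMarkovKernel κ]
    (hκ : P.map (fun ω => (evenCorner (v ω), oddRow 0 (v ω)))
      = P.map (fun ω => evenCorner (v ω)) ⊗ₘ κ)
    (i : ℕ) {D : Set (ℕ → ℝ)} (hD : MeasurableSet D) {Z : (ℕ → ℕ → ℝ) → ℝ≥0∞}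
    (hZ : Measurable Z) :
    ∫⁻ ω in (fun ω => oddRow i (v ω)) ⁻¹' D, Z (eraseOddRow i (v ω)) ∂P
      = ∫⁻ ω, Z (eraseOddRow i (v ω)) * κ (evenCorner (v ω)) D ∂P := by
  have hbase : ∀ S, MeasurableSet S → ∀ D, MeasurableSet D →
      P ((fun ω => evenCorner (v ω)) ⁻¹' S ∩ (fun ω => oddRow i (v ω)) ⁻¹' D)
        = ∫⁻ ω in (fun ω => evenCorner (v ω)) ⁻¹' S, κ (evenCorner (v ω)) D ∂P := by
    intro S hS D hD
    rw [← measure_inter_preimage_eq_of_map_prodMk_eq_compProd (by fun_prop) (by fun_prop) hκ hS hD]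
    obtain ⟨T, hTP, hTv⟩ := hT (Equiv.swap 1 (2 * i + 1)) id (Equiv.injective _)
      Function.injective_id
    rw [← hTP.measure_preimage (((by fun_prop : Measurable fun ω => evenCorner (v ω)) hS).inter
      ((by fun_prop : Measurable fun ω => oddRow 0 (v ω)) hD)).nullMeasurableSet]
    have h1 : ∀ ω, evenCorner (v (T ω)) = evenCorner (v ω) := fun ω => by
      ext r s
      simp only [evenCorner, hTv, id]
      rw [Equiv.swap_apply_of_ne_of_ne (by omega) (by omega)]
    have h2 : ∀ ω, oddRow 0 (v (T ω)) = oddRow i (v ω) := fun ω => by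
      ext s
      simp [oddRow, hTv]
    simp only [Set.preimage_inter, Set.preimage_preimage, h1, h2]
  have hlaw : P.map (fun ω => (eraseOddRow i (v ω), oddRow i (v ω)))
      = P.map (fun ω => eraseOddRow i (v ω)) ⊗ₘ κ.comap evenCorner measurable_evenCorner := by
    refine map_prodMk_eq_compProd_of_squareCylinder (by fun_prop) (by fun_prop)
      fun S hS s t ht => ?_
    have hC := measurableSet_squareCylinder s ht
    obtain ⟨n, hn⟩ : ∃ n, ∀ k ∈ s, k < n := ⟨s.sup id + 1, fun k hk =>
      Nat.lt_succ_of_le (Finset.le_sup (f := id) hk)⟩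
    obtain ⟨T, hTP, hTv⟩ := hT (fun r => if r = 2 * i + 1 then r else 2 * r)
      (fun s => if s % 2 = 0 ∧ s < 2 * n then s else 2 * (s + n))
      (fun a b hab => by dsimp only at hab; split_ifs at hab <;> omega)
      (fun a b hab => by dsimp only at hab; split_ifs at hab <;> omega)
    refine setLIntegral_eq_of_contraction hTP (ζ := fun ω => eraseOddRow i (v ω)) (by fun_prop)
      measurable_evenCorner
      (ρ := fun a r s => if r = 2 * i + 1 then 0 else
        a r (if s % 2 = 0 ∧ s < 2 * n then s / 2 else s + n))
      (measurable_array fun r s => by split_ifs <;> fun_prop) (fun ω => ?_)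
      ((by fun_prop : Measurable fun ω => oddRow i (v ω)) hC) ?_
      (κ.measurable_coe hC) (fun S hS => ?_) (measurable_one.indicator hS)
    · ext r s
      simp only [evenCorner_eraseOddRow]
      simp only [eraseOddRow, evenCorner, hTv]
      split_ifs
      · rfl
      · congr 1; omega
      · rfl
    · ext ω
      refine forall₂_congr fun k hk => ?_
      have := hn k hk
      change v (T ω) (2 * i + 1) (2 * k) ∈ t k ↔ _
      rw [hTv, if_pos rfl, if_pos (by omega)]
      rfl
    · simp_rw [evenCorner_eraseOddRow]
      exact hbase S hS _ hC
  rw [setLIntegral_eq_of_map_prodMk_eq_compProd (by fun_prop) (by fun_prop) hlaw hD hZ]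
  simp_rw [Kernel.comap_apply, evenCorner_eraseOddRow]

/-- Given the even corner of a separately exchangeable array, the `j`-th odd column is
independent of all other columns, and its conditional law does not depend on `j`. -/
theorem setLIntegral_oddCol {Ω : Type*} [MeasurableSpace Ω] {P : Measure Ω} [IsFiniteMeasure P]
    {v : Ω → ℕ → ℕ → ℝ} (hv : Measurable v)
    (hT : ∀ σ τ : ℕ → ℕ, Function.Injective σ → Function.Injective τ →
      ∃ T, MeasurePreserving T P P ∧ ∀ ω r s, v (T ω) r s = v ω (σ r) (τ s))
    {κ : Kernel (ℕ → ℕ → ℝ) (ℕ → ℝ)} [IsMarkovKernel κ]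
    (hκ : P.map (fun ω => (transposeArray (evenCorner (v ω)), oddCol 0 (v ω)))
      = P.map (fun ω => transposeArray (evenCorner (v ω))) ⊗ₘ κ)
    (j : ℕ) {D : Set (ℕ → ℝ)} (hD : MeasurableSet D) {Z : (ℕ → ℕ → ℝ) → ℝ≥0∞}
    (hZ : Measurable Z) :
    ∫⁻ ω in (fun ω => oddCol j (v ω)) ⁻¹' D, Z (eraseOddCol j (v ω)) ∂P
      = ∫⁻ ω, Z (eraseOddCol j (v ω)) * κ (transposeArray (evenCorner (v ω))) D ∂P :=
  setLIntegral_oddRow (v := fun ω => transposeArray (v ω)) (by fun_prop)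
    (fun σ τ hσ hτ => (hT τ σ hτ hσ).imp fun _ h => ⟨h.1, fun ω r s => h.2 ω s r⟩)
    hκ j hD (Z := fun z => Z (transposeArray z)) (by fun_prop)

/-- Given the even corner, the `i`-th odd row and the `j`-th odd column of a separately exchangeable
array, the entry in this row and column is independent of all other entries, and its conditional
law does not depend on `i` and `j`. -/
theorem setLIntegral_oddEntry {Ω X : Type*} [MeasurableSpace Ω] [MeasurableSpace X]
    {P : Measure Ω} [IsFiniteMeasure P] {v : Ω → ℕ → ℕ → ℝ} (hv : Measurable v)
    {x : ℕ → ℕ → Ω → X} (hx : ∀ r s, Measurable (x r s))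
    (hT : ∀ σ τ : ℕ → ℕ, Function.Injective σ → Function.Injective τ →
      ∃ T, MeasurePreserving T P P ∧ (∀ ω r s, v (T ω) r s = v ω (σ r) (τ s)) ∧
        ∀ ω r s, x r s (T ω) = x (σ r) (τ s) ω)
    {κ : Kernel ((ℕ → ℕ → ℝ) × (ℕ → ℝ) × (ℕ → ℝ)) X} [IsMarkovKernel κ]
    (hκ : P.map (fun ω => ((evenCorner (v ω), oddRow 0 (v ω), oddCol 0 (v ω)), x 1 1 ω))
      = P.map (fun ω => (evenCorner (v ω), oddRow 0 (v ω), oddCol 0 (v ω))) ⊗ₘ κ)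
    (i j : ℕ) {D : Set X} (hD : MeasurableSet D) {Z : (ℕ → ℕ → ℝ) → ℝ≥0∞}
    (hZ : Measurable Z) :
    ∫⁻ ω in x (2 * i + 1) (2 * j + 1) ⁻¹' D, Z (eraseOddEntry i j (v ω)) ∂P
      = ∫⁻ ω, Z (eraseOddEntry i j (v ω)) *
          κ (evenCorner (v ω), oddRow i (v ω), oddCol j (v ω)) D ∂P := by
  have herase : ∀ z, (evenCorner (eraseOddEntry i j z), oddRow i (eraseOddEntry i j z),
      oddCol j (eraseOddEntry i j z)) = (evenCorner z, oddRow i z, oddCol j z) := by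
    intro z
    rw [evenCorner_eraseOddEntry, oddRow_eraseOddEntry, oddCol_eraseOddEntry]
  have hbase : ∀ S, MeasurableSet S →
      P ((fun ω => (evenCorner (v ω), oddRow i (v ω), oddCol j (v ω))) ⁻¹' S ∩
          x (2 * i + 1) (2 * j + 1) ⁻¹' D)
        = ∫⁻ ω in (fun ω => (evenCorner (v ω), oddRow i (v ω), oddCol j (v ω))) ⁻¹' S,
          κ (evenCorner (v ω), oddRow i (v ω), oddCol j (v ω)) D ∂P := by
    intro S hS
    obtain ⟨T, hTP, hTv, hTx⟩ := hT (Equiv.swap 1 (2 * i + 1)) (Equiv.swap 1 (2 * j + 1))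
      (Equiv.injective _) (Equiv.injective _)
    have h1 : ∀ ω, (evenCorner (v (T ω)), oddRow 0 (v (T ω)), oddCol 0 (v (T ω)))
        = (evenCorner (v ω), oddRow i (v ω), oddCol j (v ω)) := by
      intro ω
      refine Prod.ext ?_ (Prod.ext ?_ ?_)
      · ext r s
        simp only [evenCorner, hTv]
        rw [Equiv.swap_apply_of_ne_of_ne (by omega) (by omega),
          Equiv.swap_apply_of_ne_of_ne (by omega) (by omega)]
      · ext s
        simp only [oddRow, hTv, mul_zero, zero_add, Equiv.swap_apply_left]
        rw [Equiv.swap_apply_of_ne_of_ne (by omega) (by omega)]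
      · ext r
        simp only [oddCol, hTv, mul_zero, zero_add, Equiv.swap_apply_left]
        rw [Equiv.swap_apply_of_ne_of_ne (by omega) (by omega)]
    have h2 : ∀ ω, x 1 1 (T ω) = x (2 * i + 1) (2 * j + 1) ω := fun ω => by simp [hTx]
    have hy : ∀ i j, Measurable fun ω => (evenCorner (v ω), oddRow i (v ω), oddCol j (v ω)) :=
      fun i j => by fun_prop
    have h := measure_inter_preimage_eq_of_map_prodMk_eq_compProd (hy 0 0) (hx 1 1) hκ hS hD
    rw [← hTP.measure_preimage ((hy 0 0 hS).inter (hx 1 1 hD)).nullMeasurableSet,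
      ← hTP.setLIntegral_comp_preimage
        (f := fun ω => κ (evenCorner (v ω), oddRow 0 (v ω), oddCol 0 (v ω)) D) (hy 0 0 hS)
        ((κ.measurable_coe hD).comp (hy 0 0))] at h
    simpa only [Set.preimage_inter, Set.preimage_preimage, h1, h2] using h
  obtain ⟨T, hTP, hTv, hTx⟩ := hT (fun r => if r = 2 * i + 1 then r else 2 * r)
    (fun s => if s = 2 * j + 1 then s else 2 * s)
    (fun a b hab => by dsimp only at hab; split_ifs at hab <;> omega)
    (fun a b hab => by dsimp only at hab; split_ifs at hab <;> omega)
  have h := setLIntegral_eq_of_contraction hTP (ζ := fun ω => eraseOddEntry i j (v ω))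
    (by fun_prop) (π := fun z => (evenCorner z, oddRow i z, oddCol j z)) (by fun_prop)
    (ρ := fun y r s => if r = 2 * i + 1 then (if s = 2 * j + 1 then 0 else y.2.1 s)
      else if s = 2 * j + 1 then y.2.2 r else y.1 r s)
    (measurable_array fun r s => by split_ifs <;> fun_prop) (fun ω => ?_)
    (hx (2 * i + 1) (2 * j + 1) hD) ?_ (κ.measurable_coe hD) (fun S hS => ?_) hZ
  · simpa only [herase] using h
  · ext r s
    rw [herase]
    simp only [eraseOddEntry, evenCorner, oddRow, oddCol, hTv]
    split_ifs <;> first | rfl | omega | (subst_vars; rfl)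
  · ext ω
    simp [hTx]
  · simp_rw [herase]
    exact hbase S hS

section Representation

variable {X : Type*} [MeasurableSpace X] {P : Measure (ℕ × ℕ → X)} [IsFiniteMeasure P]

/-- The law of an array which is, given `y`, made of independent entries, can be computed from the
law of `y`, obtained by sampling the corner, the columns and the rows successively. -/
theorem measure_eq_lintegral_of_condLaw {A B C : Type*} [MeasurableSpace A] [MeasurableSpace B]
    [MeasurableSpace C] {a : (ℕ × ℕ → X) → A} (ha : Measurable a) {b : (ℕ × ℕ → X) → B}
    (hb : Measurable b) {c : (ℕ × ℕ → X) → C} (hc : Measurable c)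
    {x : (ℕ × ℕ → X) → ℕ × ℕ → X} (hx : MeasurePreserving x P P)
    {F : Kernel A B} {G : Kernel A C} {H : Kernel (A × B × C) (ℕ × ℕ → X)}
    [IsMarkovKernel F] [IsMarkovKernel G] [IsMarkovKernel H]
    (hG : P.map (fun ω => (a ω, c ω)) = P.map a ⊗ₘ G)
    (hF : P.map (fun ω => ((a ω, c ω), b ω))
      = P.map (fun ω => (a ω, c ω)) ⊗ₘ F.comap Prod.fst measurable_fst)
    (hH : P.map (fun ω => ((a ω, b ω, c ω), x ω)) = P.map (fun ω => (a ω, b ω, c ω)) ⊗ₘ H) :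
    P = (P.map a).bind fun a => ((F a).prod (G a)).bind fun bc => H (a, bc.1, bc.2) := by
  ext D hD
  have hHD : Measurable fun y => H y D := H.measurable_coe hD
  have hHa : ∀ a, Measurable fun bc : B × C => H (a, bc.1, bc.2) := fun a =>
    H.measurable.comp (by fun_prop)
  have hinner : ∀ a, (((F a).prod (G a)).bind fun bc => H (a, bc.1, bc.2)) D
      = ∫⁻ c, ∫⁻ b, H (a, b, c) D ∂F a ∂G a := by
    intro a
    rw [Measure.bind_apply hD (hHa a).aemeasurable, lintegral_prod_symm _ (by fun_prop)]
  have hker : Measurable fun a => ((F a).prod (G a)).bind fun bc => H (a, bc.1, bc.2) := by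
    refine Measure.measurable_of_measurable_coe _ fun D hD => ?_
    have hm : Measurable fun p : A × B × C => H p D := H.measurable_coe hD
    have hm' : ∀ a, (((F a).prod (G a)).bind fun bc => H (a, bc.1, bc.2)) D
      = ∫⁻ p, H (a, p) D ∂(F ×ₖ G) a := by
      intro a
      rw [Measure.bind_apply hD (hHa a).aemeasurable, Kernel.prod_apply]
    simp_rw [hm']
    exact Measurable.lintegral_kernel_prod_right' hm
  rw [Measure.bind_apply hD hker.aemeasurable]
  simp_rw [hinner]
  have hΨ : Measurable fun p : A × C => ∫⁻ b, H (p.1, b, p.2) D ∂F p.1 :=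
    Measurable.lintegral_kernel_prod_right' (κ := F.comap Prod.fst measurable_fst)
      (f := fun q : (A × C) × B => H (q.1.1, q.2, q.1.2) D) (by fun_prop)
  calc P D = P (x ⁻¹' D) := (hx.measure_preimage hD.nullMeasurableSet).symm
    _ = ∫⁻ ω, H (a ω, b ω, c ω) D ∂P := by
        have := setLIntegral_eq_of_map_prodMk_eq_compProd (ha.prodMk (hb.prodMk hc))
          hx.measurable hH hD measurable_one
        simpa using this
    _ = ∫⁻ p, H (p.1.1, p.2, p.1.2) D ∂(P.map fun ω => ((a ω, c ω), b ω)) :=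
        (lintegral_map (f := fun p : (A × C) × B => H (p.1.1, p.2, p.1.2) D) (by fun_prop)
          ((ha.prodMk hc).prodMk hb)).symm
    _ = ∫⁻ p, ∫⁻ b, H (p.1, b, p.2) D ∂F p.1 ∂(P.map fun ω => (a ω, c ω)) := by
        rw [hF, Measure.lintegral_compProd (by fun_prop)]
        rfl
    _ = ∫⁻ a, ∫⁻ c, ∫⁻ b, H (a, b, c) D ∂F a ∂G a ∂(P.map a) := by
        rw [hG, Measure.lintegral_compProd hΨ]

end Representation

/-- **Aldous–Hoover Theorem (parametric weak form)**: every row-column exchangeable Markov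
kernel `p : W → (ℕ × ℕ → X)` between standard Borel spaces admits, parametrically in `w`,
an Aldous–Hoover representation. -/
theorem aldousHoover_parametric_weak
    {W X : Type*} [MeasurableSpace W] [MeasurableSpace X]
    [StandardBorelSpace W] [StandardBorelSpace X]
    (p : Kernel W (ℕ × ℕ → X)) [IsMarkovKernel p] (hp : RowColumnExchangeableKernel p) :
    ∃ (A B C : Type) (mA : MeasurableSpace A) (mB : MeasurableSpace B)
      (mC : MeasurableSpace C),
      @IsParametricAldousHooverMixture W X _ _ p A B C mA mB mC := by
  rcases isEmpty_or_nonempty W with hW | ⟨⟨w₀⟩⟩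
  · refine ⟨Empty, Empty, Empty, inferInstance, inferInstance, inferInstance, inferInstance,
      inferInstance, inferInstance, 0, 0, 0, 0, ⟨fun w => hW.elim w⟩, ⟨fun a => a.elim⟩,
      ⟨fun a => a.elim⟩, ⟨fun a => a.1.elim⟩, 0, 0, 0, fun a => a.elim, fun a => a.elim,
      fun a => a.elim, fun w => hW.elim w⟩
  have : Nonempty X := (p w₀).nonempty_of_neZero.map fun x => x (0, 0)
  have heW := measurableEmbedding_embeddingReal W
  have heX := measurable_embeddingReal X
  obtain ⟨d, hd, hde⟩ := heW.exists_measurable_extend measurable_id fun _ => ⟨w₀⟩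
  let v : (ℕ × ℕ → X) → ℕ → ℕ → ℝ := fun x r s => embeddingReal X (x (r, s))
  have hv : Measurable v := measurable_array fun r s => heX.comp (measurable_pi_apply _)
  let p' : Kernel ℝ (ℕ × ℕ → X) := p.comap d hd
  have hp' : ∀ w, p' (embeddingReal W w) = p w := fun w => by
    rw [Kernel.comap_apply]
    exact congrArg p (congrFun hde w)
  obtain ⟨f, hf, hfp⟩ := p'.exists_condLaw (y := fun x => evenCorner (v x))
    (x := fun x => oddRow 0 (v x)) (by fun_prop) (by fun_prop)
  obtain ⟨g, hg, hgp⟩ := p'.exists_condLaw (y := fun x => transposeArray (evenCorner (v x)))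
    (x := fun x => oddCol 0 (v x)) (by fun_prop) (by fun_prop)
  obtain ⟨h, hh, hhp⟩ := p'.exists_condLaw
    (y := fun x => (evenCorner (v x), oddRow 0 (v x), oddCol 0 (v x)))
    (x := fun x => x (1, 1)) (by fun_prop) (measurable_pi_apply _)
  let q : Kernel W (ℝ × (ℕ → ℕ → ℝ)) :=
    Kernel.deterministic (embeddingReal W) heW.measurable ×ₖ p.map fun x => evenCorner (v x)
  have hv' : Measurable fun x => evenCorner (v x) := by fun_prop
  have : IsMarkovKernel (p.map fun x => evenCorner (v x)) := Kernel.IsMarkovKernel.map p hv'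
  let g' : Kernel (ℝ × (ℕ → ℕ → ℝ)) (ℕ → ℝ) :=
    g.comap (fun a => (a.1, transposeArray a.2)) (by fun_prop)
  let h' : Kernel ((ℕ → ℝ) × (ℝ × (ℕ → ℕ → ℝ)) × (ℕ → ℝ)) X :=
    h.comap (fun y => (y.2.1.1, y.2.1.2, y.1, y.2.2)) (by fun_prop)
  let F := Kernel.infinitePi fun _ : ℕ => f
  let G := Kernel.infinitePi fun _ : ℕ => g'
  let κ : ∀ _ : ℕ × ℕ, Kernel ((ℝ × (ℕ → ℕ → ℝ)) × (ℕ → ℕ → ℝ) × (ℕ → ℕ → ℝ)) X := fun ij =>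
    h'.comap (fun y => (y.2.1 ij.1, y.1, y.2.2 ij.2)) (by fun_prop)
  have hκ : ∀ ij, IsMarkovKernel (κ ij) := fun ij => by
    dsimp only [κ]; infer_instance
  let H := Kernel.infinitePi κ
  refine ⟨ℝ × (ℕ → ℕ → ℝ), ℕ → ℝ, ℕ → ℝ, inferInstance, inferInstance, inferInstance,
    inferInstance, inferInstance, inferInstance, q, f, g', h', inferInstance, hf, inferInstance,
    inferInstance, F, G, H, fun a => Kernel.infinitePi_apply_squareCylinder (fun _ => f) a,
    fun a => Kernel.infinitePi_apply_squareCylinder (fun _ => g') a,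
    fun a b c => Kernel.infinitePi_apply_squareCylinder κ (a, b, c), fun w => ?_⟩
  set r := embeddingReal W w
  have hT := fun σ τ hσ hτ => measurePreserving_subarray (P := p w)
    (fun σ hσ => hp σ hσ w) (σ := σ) (τ := τ) hσ hτ
  have hTv : ∀ σ τ : ℕ → ℕ, Function.Injective σ → Function.Injective τ →
      ∃ T, MeasurePreserving T (p w) (p w) ∧ ∀ ω r s, v (T ω) r s = v ω (σ r) (τ s) :=
    fun σ τ hσ hτ => ⟨_, hT σ τ hσ hτ, fun _ _ _ => rfl⟩
  have hfw := hfp r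
  have hgw := hgp r
  have hhw := hhp r
  rw [hp'] at hfw hgw hhw
  have hrow : Measurable fun x i => oddRow i (v x) := measurable_pi_lambda _ fun i => by fun_prop
  have hcol : Measurable fun x j => oddCol j (v x) := measurable_pi_lambda _ fun i => by fun_prop
  have ha : Measurable fun x => (r, evenCorner (v x)) := by fun_prop
  have hodd := hT (fun i => 2 * i + 1) (fun j => 2 * j + 1)
    (fun _ _ h => by dsimp only at h; omega) (fun _ _ h => by dsimp only at h; omega)
  have hq : q w = (p w).map fun x => (r, evenCorner (v x)) := by
    rw [Kernel.prod_apply, Kernel.deterministic_apply, Measure.dirac_prod,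
      Kernel.map_apply _ hv', Measure.map_map (by fun_prop) hv']
    rfl
  rw [hq]
  refine measure_eq_lintegral_of_condLaw ha hrow hcol hodd ?_ ?_ ?_
  · refine map_prodMk_eq_compProd_infinitePi ha hcol (fun _ => g') fun j D hD s hj t ht u hu => ?_
    have hu' : Measurable fun z => u (r, evenCorner z) := by fun_prop
    have key := setLIntegral_oddCol hv hTv hgw j hD
      (Z := fun z => u (r, evenCorner z) * ∏ l ∈ s, (t l).indicator 1 (oddCol l z))
      (hu'.mul (Finset.measurable_fun_prod _ fun l _ =>
        (measurable_one.indicator (ht l)).comp (measurable_oddCol l)))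
    have hZ : ∀ z, u (r, evenCorner (eraseOddCol j z)) *
          ∏ l ∈ s, (t l).indicator (1 : (ℕ → ℝ) → ℝ≥0∞) (oddCol l (eraseOddCol j z))
        = u (r, evenCorner z) * ∏ l ∈ s, (t l).indicator 1 (oddCol l z) := fun z => by
      rw [evenCorner_eraseOddCol]
      congr 1
      exact Finset.prod_congr rfl fun l hl => by
        rw [oddCol_eraseOddCol (ne_of_mem_of_not_mem hl hj)]
    simp only [hZ] at key
    exact key
  · refine map_prodMk_eq_compProd_infinitePi (ha.prodMk hcol) hrow
      (fun _ => f.comap Prod.fst measurable_fst) fun i D hD s hi t ht u hu => ?_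
    have hu' : Measurable fun z => u ((r, evenCorner z), fun j => oddCol j z) :=
      hu.comp ((by fun_prop : Measurable fun z => (r, evenCorner z)).prodMk
        (measurable_pi_lambda _ measurable_oddCol))
    have key := setLIntegral_oddRow hv hTv hfw i hD
      (Z := fun z => u ((r, evenCorner z), fun j => oddCol j z) *
        ∏ l ∈ s, (t l).indicator 1 (oddRow l z))
      (hu'.mul (Finset.measurable_fun_prod _ fun l _ =>
        (measurable_one.indicator (ht l)).comp (measurable_oddRow l)))
    have hZ : ∀ z, u ((r, evenCorner (eraseOddRow i z)), fun j => oddCol j (eraseOddRow i z)) *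
          ∏ l ∈ s, (t l).indicator (1 : (ℕ → ℝ) → ℝ≥0∞) (oddRow l (eraseOddRow i z))
        = u ((r, evenCorner z), fun j => oddCol j z) *
          ∏ l ∈ s, (t l).indicator 1 (oddRow l z) := fun z => by
      simp_rw [evenCorner_eraseOddRow, oddCol_eraseOddRow]
      congr 1
      exact Finset.prod_congr rfl fun l hl => by
        rw [oddRow_eraseOddRow (ne_of_mem_of_not_mem hl hi)]
    simp only [hZ] at key
    exact key
  · refine map_prodMk_eq_compProd_infinitePi (ha.prodMk (hrow.prodMk hcol)) hodd.measurable κ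
      fun ij D hD s hij t ht u hu => ?_
    obtain ⟨dX, hdX, hdXe⟩ := (measurableEmbedding_embeddingReal X).exists_measurable_extend
      measurable_id fun _ => ‹Nonempty X›
    have hu' : Measurable fun z =>
        u ((r, evenCorner z), (fun i => oddRow i z), fun j => oddCol j z) :=
      hu.comp ((by fun_prop : Measurable fun z => (r, evenCorner z)).prodMk
        ((measurable_pi_lambda _ measurable_oddRow).prodMk
          (measurable_pi_lambda _ measurable_oddCol)))
    have key := setLIntegral_oddEntry hv (x := fun r s ω => ω (r, s))
      (fun r s => measurable_pi_apply _)
      (fun σ τ hσ hτ => ⟨_, hT σ τ hσ hτ, fun _ _ _ => rfl, fun _ _ _ => rfl⟩) hhw ij.1 ij.2 hD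
      (Z := fun z => u ((r, evenCorner z), (fun i => oddRow i z), fun j => oddCol j z) *
        ∏ l ∈ s, (t l).indicator 1 (dX (z (2 * l.1 + 1) (2 * l.2 + 1))))
      (hu'.mul (Finset.measurable_fun_prod _ fun l _ =>
        (measurable_one.indicator (ht l)).comp (hdX.comp (measurable_array_apply _ _))))
    have hZ : ∀ ω, u ((r, evenCorner (eraseOddEntry ij.1 ij.2 (v ω))),
          (fun i => oddRow i (eraseOddEntry ij.1 ij.2 (v ω))),
          fun j => oddCol j (eraseOddEntry ij.1 ij.2 (v ω))) *
          ∏ l ∈ s, (t l).indicator (1 : X → ℝ≥0∞)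
            (dX (eraseOddEntry ij.1 ij.2 (v ω) (2 * l.1 + 1) (2 * l.2 + 1)))
        = u ((r, evenCorner (v ω)), (fun i => oddRow i (v ω)), fun j => oddCol j (v ω)) *
          ∏ l ∈ s, (t l).indicator 1 (ω (2 * l.1 + 1, 2 * l.2 + 1)) := fun ω => by
      simp_rw [evenCorner_eraseOddEntry, oddRow_eraseOddEntry, oddCol_eraseOddEntry]
      congr 1
      refine Finset.prod_congr rfl fun l hl => ?_
      have hl' : ¬(2 * l.1 + 1 = 2 * ij.1 + 1 ∧ 2 * l.2 + 1 = 2 * ij.2 + 1) := fun h =>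
        hij ((Prod.ext (by omega) (by omega) : ij = l) ▸ hl)
      rw [eraseOddEntry, if_neg hl']
      exact congrArg _ (congrFun hdXe _)
    simp only [hZ] at key
    exact key
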